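/- Suppose d < δ and d ≥ σ. Then every monomial of B_{d+1} ∪ ⋯ ∪ B_{d+i*} is divisible by x_n, and consequently every generator of in(I,g) lying in B_{d+i} for some 1 ≤ i ≤ i* satisfies property P with respect to in(I,g). -/

import Mathlib

open MvPolynomial

/-- The total degree of an exponent vector. -/
def expDeg {n : ℕ} (μ : Fin n →₀ ℕ) : ℕ := μ.sum fun _ e => e

/-- Strict degree reverse lexicographic order on exponent vectors, for variables
`x_1 > ⋯ > x_n` (indexed by `Fin n` in this order). -/
def DrlLT {n : ℕ} (a b : Fin n →₀ ℕ) : Prop :=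
  expDeg a < expDeg b ∨
    (expDeg a = expDeg b ∧ ∃ i : Fin n, b i < a i ∧ ∀ j : Fin n, i < j → a j = b j)

/-- `μ` is the leading (degrevlex-largest) exponent of `p`. -/
def IsLeadExp {n : ℕ} {K : Type*} [CommSemiring K] (p : MvPolynomial (Fin n) K)
    (μ : Fin n →₀ ℕ) : Prop :=
  μ ∈ p.support ∧ ∀ ν ∈ p.support, ν ≠ μ → DrlLT ν μ

/-- The initial ideal of `I` with respect to the degree reverse lexicographic order. -/
noncomputable def initialIdeal {n : ℕ} {K : Type*} [CommRing K]
    (I : Ideal (MvPolynomial (Fin n) K)) : Ideal (MvPolynomial (Fin n) K) :=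
  Ideal.span { m | ∃ p ∈ I, p ≠ 0 ∧ ∃ μ, IsLeadExp p μ ∧ m = monomial μ (1 : K) }

/-- The standard monomials of degree `i` of `I` : exponents of the monomials of degree `i`
not lying in the initial ideal of `I`. -/
def stdMon {n : ℕ} {K : Type*} [CommRing K] (I : Ideal (MvPolynomial (Fin n) K)) (i : ℕ) :
    Set (Fin n →₀ ℕ) :=
  { μ | expDeg μ = i ∧ monomial μ (1 : K) ∉ initialIdeal I }

/-- `μ` is a minimal monomial generator of the monomial ideal `M`. -/
def IsMinGen {n : ℕ} {K : Type*} [CommRing K] (M : Ideal (MvPolynomial (Fin n) K))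
    (μ : Fin n →₀ ℕ) : Prop :=
  monomial μ (1 : K) ∈ M ∧ ∀ ν : Fin n →₀ ℕ, ν ≤ μ → ν ≠ μ → monomial ν (1 : K) ∉ M

/-- `μ` satisfies property `P` with respect to the monomial ideal `M`: if `m` is the largest
index of a variable dividing `x^μ`, then every monomial of the same degree in the variables of
index `< m` also lies in `M`. -/
def SatisfiesP {n : ℕ} {K : Type*} [CommRing K] (M : Ideal (MvPolynomial (Fin n) K))
    (μ : Fin n →₀ ℕ) : Prop :=
  ∀ m : Fin n, μ m ≠ 0 → (∀ j : Fin n, m < j → μ j = 0) →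
    ∀ ν : Fin n →₀ ℕ, expDeg ν = expDeg μ → (∀ j : Fin n, m ≤ j → ν j = 0) →
      monomial ν (1 : K) ∈ M

/-- Conjecture E (Pardue) holds for the ideal `I`: every minimal generator of the initial
ideal of `I` satisfies property `P`. -/
def ConjE {n : ℕ} {K : Type*} [CommRing K] (I : Ideal (MvPolynomial (Fin n) K)) : Prop :=
  ∀ μ, IsMinGen (initialIdeal I) μ → SatisfiesP (initialIdeal I) μ

/-- `f` is a generic sequence of forms of degrees `d i` over the base field `F`: each `f i` is
homogeneous of degree `d i` and the family of all coefficients (at all monomials of degree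
`d i`) is algebraically independent over `F`. -/
def IsGenericSeq (F : Type*) {K : Type*} [CommRing F] [CommRing K] [Algebra F K]
    {n r : ℕ} (d : Fin r → ℕ) (f : Fin r → MvPolynomial (Fin n) K) : Prop :=
  (∀ i, (f i).IsHomogeneous (d i)) ∧
    AlgebraicIndependent F
      (fun p : Σ i : Fin r, { μ : Fin n →₀ ℕ // expDeg μ = d i } => (f p.1).coeff p.2.1)

/-- The projection `K[x_1,…,x_n,z] → K[x_1,…,x_n]` sending `z` (the last variable) to `0` and
fixing the other variables. -/
noncomputable def projMap (K : Type*) [CommRing K] (n : ℕ) :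
    MvPolynomial (Fin (n + 1)) K →ₐ[K] MvPolynomial (Fin n) K :=
  aeval (fun i => Fin.lastCases 0 (fun j => X j) i)

/-- Embedding of exponent vectors of `K[x_1,…,x_n]` into those of `K[x_1,…,x_n,z]`
(`z`-exponent `0`). -/
noncomputable def embExp {n : ℕ} (μ : Fin n →₀ ℕ) : Fin (n + 1) →₀ ℕ :=
  Finsupp.embDomain ⟨Fin.castSucc, Fin.castSucc_injective n⟩ μ

/-- Multiplication by `z^c` on exponent vectors in `K[x_1,…,x_n,z]`. -/
noncomputable def zShift {n : ℕ} (c : ℕ) (μ : Fin (n + 1) →₀ ℕ) : Fin (n + 1) →₀ ℕ :=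
  μ + Finsupp.single (Fin.last n) c

/-- `f` (homogeneous of degree `e`) is semi-regular on `R/I`: in each degree `t`, the
multiplication map `(R/I)_t → (R/I)_{t+e}` is injective or surjective. -/
def SemiRegularOn {vars K : Type*} [CommRing K] (I : Ideal (MvPolynomial vars K))
    (f : MvPolynomial vars K) (e : ℕ) : Prop :=
  ∀ t : ℕ,
    (∀ p ∈ homogeneousSubmodule vars K t, f * p ∈ I → p ∈ I) ∨
    (∀ q ∈ homogeneousSubmodule vars K (t + e),
      ∃ p ∈ homogeneousSubmodule vars K t, q - f * p ∈ I)

/-- The degree-`t` graded piece of `R/I`, as a `K`-submodule of the quotient. -/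
noncomputable def quotDegPart {vars K : Type*} [CommRing K] (I : Ideal (MvPolynomial vars K))
    (t : ℕ) : Submodule K (MvPolynomial vars K ⧸ I) :=
  (homogeneousSubmodule vars K t).map (Ideal.Quotient.mkₐ K I).toLinearMap

/-- `w` lies in the span of elements `y ^ j * u` of label `N = a + j`, where `u` has label `a` and
is killed modulo `P` by a power `y ^ k` with `2 * a + k ≤ s + 1`. When `s` is the socle degree,
this says that the `y`-strings generated by the `u` are centred at or below the middle. -/
def stringSpan (K : Type*) {S : Type*} [CommRing K] [CommRing S] [Algebra K S]
    (P : Ideal S) (y : S) (s N : ℕ) : Submodule K S :=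
  P.restrictScalars K ⊔ Submodule.span K
    { w | ∃ a k j u, a + j = N ∧ 2 * a + k ≤ s + 1 ∧ y ^ k * u ∈ P ∧ w = y ^ j * u }

/-- All Toeplitz minors of size at most `B` with a coefficient of index at most `b` on the
diagonal are nonzero. -/
def ToeplitzRegular {K : Type*} [CommRing K] (b B : ℕ) (p : Polynomial K) : Prop :=
  p.natDegree ≤ b ∧ ∀ a ≤ b, ∀ L ≤ B,
    (Matrix.of fun i j : Fin L => (p * Polynomial.X ^ (j : ℕ)).coeff (a + i)).det ≠ 0

lemma exists_toeplitzRegular (K : Type*) [Field K] [Infinite K] (b B : ℕ) :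
    ∃ p : Polynomial K, ToeplitzRegular b B p := by
  classical
  let T (a L : ℕ) : Matrix (Fin L) (Fin L) (MvPolynomial ℕ K) :=
    Matrix.of fun i j : Fin L =>
      if (j : ℕ) ≤ a + i ∧ a + i - j ≤ b then X (a + i - j) else 0
  have hT : ∀ a ≤ b, ∀ L, (T a L).det ≠ 0 := by
    intro a ha L h
    have h1 := congrArg (aeval fun r : ℕ => if r = a then (1 : K) else 0) h
    rw [AlgHom.map_det, map_zero] at h1
    have h2 : (aeval fun r : ℕ => if r = a then (1 : K) else 0).mapMatrix (T a L) = 1 := by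
      ext i j
      simp only [T, AlgHom.mapMatrix_apply, Matrix.map_apply, Matrix.of_apply, Matrix.one_apply,
        apply_ite (aeval fun r : ℕ => if r = a then (1 : K) else 0), map_zero, aeval_X, Fin.ext_iff]
      split_ifs <;> first | rfl | omega
    rw [h2, Matrix.det_one] at h1
    exact one_ne_zero h1
  have hprod : ∏ a ∈ Finset.range (b + 1), ∏ L ∈ Finset.range (B + 1), (T a L).det ≠ 0 :=
    Finset.prod_ne_zero_iff.2 fun a ha => Finset.prod_ne_zero_iff.2 fun L _ =>
      hT a (Nat.lt_succ_iff.1 (Finset.mem_range.1 ha)) L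
  obtain ⟨c, hc⟩ : ∃ c : ℕ → K, eval c
      (∏ a ∈ Finset.range (b + 1), ∏ L ∈ Finset.range (B + 1), (T a L).det) ≠ 0 := by
    by_contra! h
    exact hprod (MvPolynomial.funext fun c => by rw [h c, map_zero])
  let p : Polynomial K := ∑ r ∈ Finset.range (b + 1), Polynomial.monomial r (c r)
  have hp : ∀ r, p.coeff r = if r ≤ b then c r else 0 := by
    intro r
    simp [p, Polynomial.coeff_monomial]
  refine ⟨p, Polynomial.natDegree_le_iff_coeff_eq_zero.2 fun r hr => ?_, fun a ha L hL => ?_⟩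
  · rw [hp, if_neg (by omega)]
  · rw [map_prod, Finset.prod_ne_zero_iff] at hc
    have h1 := hc a (Finset.mem_range.2 (by omega))
    rw [map_prod, Finset.prod_ne_zero_iff] at h1
    have h2 := h1 L (Finset.mem_range.2 (by omega))
    rw [RingHom.map_det] at h2
    convert h2 using 2
    ext i j
    simp only [T, RingHom.mapMatrix_apply, Matrix.map_apply, Matrix.of_apply,
      Polynomial.coeff_mul_X_pow', hp, apply_ite (eval c), eval_X, map_zero]
    split_ifs <;> first | rfl | omega

namespace ToeplitzRegular

variable {K : Type*} [Field K] {b B : ℕ} {p : Polynomial K}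

lemma coeff_ne_zero (hp : ToeplitzRegular b B p) (hB : 1 ≤ B) : p.coeff b ≠ 0 := by
  simpa using hp.2 b le_rfl 1 hB

lemma exists_mul_coeff_eq (hp : ToeplitzRegular b B p) {a k : ℕ} (hab : a ≤ b) (hak : a < k)
    (hk : k ≤ B) : ∃ q : Polynomial K, q.natDegree ≤ k - 1 - a ∧ (p * q).coeff a = 1 ∧
      ∀ t, a < t → t < k → (p * q).coeff t = 0 := by
  classical
  obtain ⟨L, rfl⟩ : ∃ L, k = a + (L + 1) := ⟨k - a - 1, by omega⟩
  set M := Matrix.of fun i j : Fin (L + 1) => (p * Polynomial.X ^ (j : ℕ)).coeff (a + i) with hM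
  have hdet : IsUnit M.det := (hp.2 a hab (L + 1) (by omega)).isUnit
  let c : Fin (L + 1) → K := M⁻¹.mulVec (Pi.single 0 1)
  have hc : M.mulVec c = Pi.single 0 1 := by
    rw [Matrix.mulVec_mulVec, Matrix.mul_nonsing_inv _ hdet, Matrix.one_mulVec]
  let q : Polynomial K := ∑ j : Fin (L + 1), Polynomial.C (c j) * Polynomial.X ^ (j : ℕ)
  have hq : ∀ i : Fin (L + 1), (p * q).coeff (a + i) = Pi.single (M := fun _ => K) 0 1 i := by
    intro i
    rw [← hc, Finset.mul_sum, Polynomial.finsetSum_coeff, Matrix.mulVec, dotProduct]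
    refine Finset.sum_congr rfl fun j _ => ?_
    rw [mul_left_comm, Polynomial.coeff_C_mul, hM, Matrix.of_apply, mul_comm]
  refine ⟨q, ?_, by simpa using hq 0, fun t hat htk => ?_⟩
  · refine Polynomial.natDegree_sum_le_of_forall_le _ _ fun j _ => ?_
    exact (Polynomial.natDegree_C_mul_X_pow_le _ _).trans (by omega)
  · obtain ⟨i, rfl⟩ := Nat.exists_eq_add_of_lt hat
    have := hq ⟨i + 1, by omega⟩
    rwa [Pi.single_eq_of_ne (by simp [Fin.ext_iff])] at this

end ToeplitzRegular

section BinaryForm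

variable {K S : Type*} [Field K] [CommRing S] [Algebra K S]

/-- The value at `(x, y)` of the binary form of degree `b` with dehomogenization `p`. -/
noncomputable def binaryForm (p : Polynomial K) (b : ℕ) (x y : S) : S :=
  aeval ![x, y] (p.homogenize b)

lemma binaryForm_eq_sum (p : Polynomial K) (b : ℕ) (x y : S) :
    binaryForm p b x y = ∑ t ∈ Finset.range (b + 1), p.coeff t • (x ^ t * y ^ (b - t)) := by
  rw [binaryForm, Polynomial.homogenize, map_sum, Finset.Nat.sum_antidiagonal_eq_sum_range_succ_mk]
  refine Finset.sum_congr rfl fun t _ => ?_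
  rw [Finsupp.update_eq_add_single (by simp), aeval_monomial, Finsupp.prod_add_index']
  · simp [Algebra.smul_def]
  · simp
  · simp [pow_add]

lemma binaryForm_mul {p q : Polynomial K} {b c : ℕ} (hp : p.natDegree ≤ b) (hq : q.natDegree ≤ c)
    (x y : S) : binaryForm (p * q) (b + c) x y = binaryForm p b x y * binaryForm q c x y := by
  simp only [binaryForm, Polynomial.homogenize_mul p q hp hq, map_mul]

lemma ToeplitzRegular.exists_monic_form {b B : ℕ} {p : Polynomial K} (hp : ToeplitzRegular b B p)
    {a k : ℕ} (hab : a < b) (hak : a < k) (hk : k ≤ B) (x y : S) :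
    ∃ h : ℕ → K, y ^ (k + b - 1 - 2 * a) *
      (x ^ a + ∑ t ∈ Finset.range a, h t • (x ^ t * y ^ (a - t))) ∈
        Ideal.span {x ^ k, binaryForm p b x y} := by
  obtain ⟨q, hqd, hqa, hq0⟩ := hp.exists_mul_coeff_eq hab.le hak hk
  refine ⟨(p * q).coeff, ?_⟩
  have hmul := binaryForm_mul hp.1 hqd x y
  have hsplit : Finset.range (b + (k - 1 - a) + 1) =
      Finset.range (k + (b - a)) := by congr 1; omega
  rw [binaryForm_eq_sum, hsplit, Finset.sum_range_add, ← Nat.add_sub_cancel' hak,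
    Nat.succ_eq_add_one, Finset.sum_range_add, Finset.sum_range_succ, hqa, one_smul,
    Finset.sum_eq_zero (s := Finset.range (k - (a + 1))) (fun t ht => ?_), add_zero,
    Nat.add_sub_cancel' hak] at hmul
  · have hlow : y ^ (k + b - 1 - 2 * a) *
        (x ^ a + ∑ t ∈ Finset.range a, (p * q).coeff t • (x ^ t * y ^ (a - t))) =
        binaryForm p b x y * binaryForm q (k - 1 - a) x y -
          ∑ t ∈ Finset.range (b - a), (p * q).coeff (k + t) •
            (x ^ (k + t) * y ^ (b + (k - 1 - a) - (k + t))) := by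
      rw [← hmul, add_sub_cancel_right, mul_add, Finset.mul_sum, add_comm]
      congr 1
      · refine Finset.sum_congr rfl fun t ht => ?_
        have := Finset.mem_range.1 ht
        rw [mul_smul_comm, mul_left_comm, ← pow_add]
        congr 4
        omega
      · rw [mul_comm]
        congr 2
        omega
    rw [hlow]
    refine sub_mem (Ideal.mul_mem_right _ _ (Ideal.subset_span (by simp))) (sum_mem fun t _ => ?_)
    rw [Algebra.smul_def, pow_add, mul_assoc]
    exact Ideal.mul_mem_left _ _ (Ideal.mul_mem_right _ _ (Ideal.subset_span (by simp)))
  · rw [hq0 _ (by omega) (by have := Finset.mem_range.1 ht; omega), zero_smul]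

lemma mem_stringSpan_of_mem {P : Ideal S} {w : S} (hw : w ∈ P) (y : S) (s N : ℕ) :
    w ∈ stringSpan K P y s N :=
  Submodule.mem_sup_left (by simpa using hw)

lemma pow_mul_mem_stringSpan {P : Ideal S} {y u : S} {s a k : ℕ} (h : 2 * a + k ≤ s + 1)
    (hu : y ^ k * u ∈ P) (j : ℕ) {N : ℕ} (hN : a + j = N) : y ^ j * u ∈ stringSpan K P y s N :=
  Submodule.mem_sup_right (Submodule.subset_span ⟨a, k, j, u, hN, h, hu, rfl⟩)

lemma stringSpan_le {P : Ideal S} {y : S} {s N : ℕ} {W : Submodule K S}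
    (hP : ∀ w ∈ P, w ∈ W)
    (h : ∀ a k j u, a + j = N → 2 * a + k ≤ s + 1 → y ^ k * u ∈ P → y ^ j * u ∈ W) :
    stringSpan K P y s N ≤ W := by
  refine sup_le (fun w hw => hP w (by simpa using hw)) (Submodule.span_le.2 ?_)
  rintro _ ⟨a, k, j, u, hN, hk, hu, rfl⟩
  exact h a k j u hN hk hu

lemma ToeplitzRegular.pow_mul_pow_mul_mem_stringSpan {b B : ℕ} {p : Polynomial K}
    (hp : ToeplitzRegular b B p) {P : Ideal S} {x y u : S} {s a k : ℕ}
    (hxu : x ^ k * u ∈ P) (hG : binaryForm p b x y ∈ P) (hak : 2 * a + k ≤ s + 1)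
    (hsB : s + 1 ≤ B) :
    ∀ j e N, a + j + e = N → x ^ j * y ^ e * u ∈ stringSpan K P y (s + (b - 1)) N := by
  intro j
  induction j using Nat.strong_induction_on with
  | _ j ih =>
  intro e N hN
  by_cases hjk : k ≤ j
  · obtain ⟨i, rfl⟩ := Nat.exists_eq_add_of_le hjk
    refine mem_stringSpan_of_mem ?_ _ _ _
    rw [show x ^ (k + i) * y ^ e * u = x ^ i * y ^ e * (x ^ k * u) by ring]
    exact P.mul_mem_left _ hxu
  by_cases hjb : b ≤ j
  · obtain ⟨i, rfl⟩ := Nat.exists_eq_add_of_le hjb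
    have hb0 : p.coeff b ≠ 0 := hp.coeff_ne_zero (by omega)
    have hform := binaryForm_eq_sum p b x y
    rw [Finset.sum_range_succ, Nat.sub_self, pow_zero, mul_one] at hform
    have hx : p.coeff b • (x ^ (b + i) * y ^ e * u) = x ^ i * y ^ e * u * binaryForm p b x y -
        ∑ t ∈ Finset.range b, p.coeff t • (x ^ (t + i) * y ^ (b - t + e) * u) := by
      rw [eq_sub_iff_add_eq, hform, mul_add, Finset.mul_sum, add_comm, mul_smul_comm]
      congr 1
      · refine Finset.sum_congr rfl fun t _ => ?_
        rw [mul_smul_comm]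
        congr 1
        ring
      · congr 1
        ring
    rw [← Submodule.smul_mem_iff _ hb0, hx]
    refine sub_mem (mem_stringSpan_of_mem (P.mul_mem_left _ hG) _ _ _) (sum_mem fun t ht => ?_)
    have := Finset.mem_range.1 ht
    exact Submodule.smul_mem _ _ (ih (t + i) (by omega) _ _ (by omega))
  · push Not at hjk hjb
    obtain ⟨h, hv⟩ := hp.exists_monic_form hjb hjk (by omega) x y
    set v := x ^ j + ∑ t ∈ Finset.range j, h t • (x ^ t * y ^ (j - t)) with hvdef
    have hvu : y ^ (k + b - 1 - 2 * j) * (v * u) ∈ P := by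
      rw [← mul_assoc]
      obtain ⟨c, c', hc⟩ := Ideal.mem_span_pair.1 hv
      rw [← hc, show (c * x ^ k + c' * binaryForm p b x y) * u =
        c * (x ^ k * u) + c' * u * binaryForm p b x y by ring]
      exact add_mem (P.mul_mem_left _ hxu) (P.mul_mem_left _ hG)
    have hx : x ^ j * y ^ e * u = y ^ e * (v * u) -
        ∑ t ∈ Finset.range j, h t • (x ^ t * y ^ (j - t + e) * u) := by
      rw [hvdef, add_mul, mul_add, Finset.sum_mul, Finset.mul_sum, add_sub_assoc,
        ← Finset.sum_sub_distrib, Finset.sum_eq_zero, add_zero]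
      · ring
      · intro t _
        rw [smul_mul_assoc, mul_smul_comm, ← smul_sub]
        convert smul_zero _
        ring
    rw [hx]
    refine sub_mem (pow_mul_mem_stringSpan (a := a + j) (by omega) hvu e (by omega))
      (sum_mem fun t ht => ?_)
    have := Finset.mem_range.1 ht
    exact Submodule.smul_mem _ _ (ih t (by omega) _ _ (by omega))

end BinaryForm

section Chain

variable {K S : Type*} [Field K] [CommRing S] [Algebra K S]

/-- The ideal generated by the binary forms `p i` of degree `b i` in consecutive elements
`x i, x (i + 1)`, for `i < m`. -/
noncomputable def chainIdeal (p : ℕ → Polynomial K) (b : ℕ → ℕ) (x : ℕ → S) (m : ℕ) : Ideal S :=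
  Ideal.span ((fun i => binaryForm (p i) (b i) (x i) (x (i + 1))) '' Set.Iio m)

lemma chainIdeal_mono (p : ℕ → Polynomial K) (b : ℕ → ℕ) (x : ℕ → S) :
    Monotone (chainIdeal p b x) := fun _ _ h =>
  Ideal.span_mono (Set.image_mono (Set.Iio_subset_Iio h))

lemma prod_pow_mem_stringSpan {p : ℕ → Polynomial K} {b : ℕ → ℕ} {x : ℕ → S} {B : ℕ}
    (hx : x 0 = 0) (hp : ∀ i, ToeplitzRegular (b i) B (p i)) (e : ℕ → ℕ) :
    ∀ m, ∑ i ∈ Finset.range m, (b i - 1) + 1 ≤ B →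
      ∏ i ∈ Finset.range m, x (i + 1) ^ e i ∈
        stringSpan K (chainIdeal p b x m) (x m) (∑ i ∈ Finset.range m, (b i - 1))
          (∑ i ∈ Finset.range m, e i) := by
  intro m
  induction m with
  | zero =>
    intro _
    simpa using pow_mul_mem_stringSpan (K := K) (P := chainIdeal p b x 0) (y := x 0) (u := 1)
      (s := 0) (a := 0) (k := 1) (by simp) (by simp [hx]) 0 rfl
  | succ m ih =>
    intro hB
    rw [Finset.sum_range_succ] at hB
    rw [Finset.prod_range_succ, Finset.sum_range_succ, Finset.sum_range_succ]
    refine (stringSpan_le (W := (stringSpan K (chainIdeal p b x (m + 1)) (x (m + 1)) _ _).comap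
      (LinearMap.mulRight K (x (m + 1) ^ e m))) ?_ ?_) (ih (by omega))
    · intro w hw
      exact mem_stringSpan_of_mem
        (Ideal.mul_mem_right _ _ (chainIdeal_mono p b x (Nat.le_succ m) hw)) _ _ _
    · intro a k j u hN hk hu
      rw [Submodule.mem_comap, LinearMap.mulRight_apply, mul_right_comm]
      exact (hp m).pow_mul_pow_mul_mem_stringSpan
        (chainIdeal_mono p b x (Nat.le_succ m) hu)
        (Ideal.subset_span ⟨m, by simp, rfl⟩) hk (by omega) _ _ _ (by omega)

lemma prod_pow_mem_chainIdeal {p : ℕ → Polynomial K} {b : ℕ → ℕ} {x : ℕ → S} {B : ℕ}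
    (hx : x 0 = 0) (hp : ∀ i, ToeplitzRegular (b i) B (p i)) (e : ℕ → ℕ) {m : ℕ}
    (hB : ∑ i ∈ Finset.range m, (b i - 1) + 1 ≤ B)
    (he : ∑ i ∈ Finset.range m, (b i - 1) < ∑ i ∈ Finset.range m, e i) :
    ∏ i ∈ Finset.range m, x (i + 1) ^ e i ∈ chainIdeal p b x m := by
  refine (stringSpan_le (W := (chainIdeal p b x m).restrictScalars K) (fun w hw => hw) ?_)
    (prod_pow_mem_stringSpan hx hp e m hB)
  intro a k j u hN hk hu
  obtain ⟨i, rfl⟩ := Nat.exists_eq_add_of_le (show k ≤ j by omega)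
  rw [add_comm, pow_add, mul_assoc]
  exact Ideal.mul_mem_left _ _ hu

lemma prod_pow_mem_chainIdeal_sup {p : ℕ → Polynomial K} {b : ℕ → ℕ} {x : ℕ → S} {B : ℕ}
    (hx : x 0 = 0) (hp : ∀ i, ToeplitzRegular (b i) B (p i)) (e : ℕ → ℕ) {m : ℕ}
    (hB : ∑ i ∈ Finset.range m, (b i - 1) + 1 ≤ B)
    (he : ∑ i ∈ Finset.range m, (b i - 1) < 2 * ∑ i ∈ Finset.range m, e i) :
    ∏ i ∈ Finset.range m, x (i + 1) ^ e i ∈ chainIdeal p b x m ⊔ Ideal.span {x m} := by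
  refine (stringSpan_le (W := (chainIdeal p b x m ⊔ Ideal.span {x m}).restrictScalars K)
    (fun w hw => Ideal.mem_sup_left hw) ?_) (prod_pow_mem_stringSpan hx hp e m hB)
  intro a k j u hN hk hu
  rcases Nat.eq_zero_or_pos j with rfl | hj
  · obtain rfl : k = 0 := by omega
    exact Ideal.mem_sup_left hu
  · obtain ⟨i, rfl⟩ := Nat.exists_eq_add_of_le' hj
    refine Ideal.mem_sup_right (Ideal.mem_span_singleton.2 ⟨x m ^ i * u, ?_⟩)
    rw [Nat.succ_eq_add_one]
    ring

end Chain

section Specialization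

/-- If the columns of a matrix of polynomials span after some specialization, they span after
specializing to algebraically independent elements. -/
lemma span_range_aeval_eq_top {F K ι ρ κ : Type*} [Field F] [Field K] [Algebra F K] [Finite ρ]
    (M : ρ → κ → MvPolynomial ι F) {c c₀ : ι → K} (hc : AlgebraicIndependent F c)
    (h : Submodule.span K (Set.range fun q r => aeval c₀ (M r q)) = ⊤) :
    Submodule.span K (Set.range fun q r => aeval c (M r q)) = ⊤ := by
  classical
  have := Fintype.ofFinite ρ
  obtain ⟨κ', a, -, hspan, hli⟩ := exists_linearIndependent' K fun q r => aeval c₀ (M r q)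
  let e : ρ ≃ κ' := (Pi.basisFun K ρ).indexEquiv (Module.Basis.mk hli (hspan.trans h).ge)
  let N : Matrix ρ ρ (MvPolynomial ι F) := Matrix.of fun r r' => M r (a (e r'))
  have h₀ : ((aeval c₀).mapMatrix N).det ≠ 0 :=
    (Matrix.isUnit_iff_isUnit_det _).1
      (Matrix.linearIndependent_cols_iff_isUnit.1 (hli.comp e e.injective)) |>.ne_zero
  have h₁ : ((aeval c).mapMatrix N).det ≠ 0 := by
    rw [← AlgHom.map_det] at h₀ ⊢
    intro hN
    rw [(map_eq_zero_iff _ hc).1 hN, map_zero] at h₀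
    exact h₀ rfl
  have hli' : LinearIndependent K fun r' r => aeval c (M r (a (e r'))) :=
    Matrix.linearIndependent_cols_iff_isUnit.2 ((Matrix.isUnit_iff_isUnit_det _).2 h₁.isUnit)
  rw [eq_top_iff, ← hli'.span_eq_top_of_card_eq_finrank' (by simp)]
  exact Submodule.span_mono (Set.range_subset_iff.2 fun r' => ⟨a (e r'), rfl⟩)

lemma restrictScalars_ideal_span_range {σ K κ : Type*} [Finite κ] [CommRing K]
    (f : κ → MvPolynomial σ K) :
    (Ideal.span (Set.range f)).restrictScalars K =
      Submodule.span K (Set.range fun q : κ × (σ →₀ ℕ) => monomial q.2 1 * f q.1) := by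
  have := Fintype.ofFinite κ
  refine le_antisymm (fun p hp => ?_) (Submodule.span_le.2 ?_)
  · obtain ⟨c, rfl⟩ := Ideal.mem_span_range_iff_exists_fun.1 hp
    refine sum_mem fun i _ => ?_
    rw [(c i).as_sum, Finset.sum_mul]
    refine sum_mem fun ν _ => ?_
    rw [← mul_one ((c i).coeff ν), ← smul_eq_mul (c i |>.coeff ν), ← smul_monomial, smul_mul_assoc]
    exact Submodule.smul_mem _ _ (Submodule.subset_span ⟨(i, ν), rfl⟩)
  · rintro _ ⟨q, rfl⟩
    exact Ideal.mul_mem_left _ _ (Ideal.subset_span ⟨q.1, rfl⟩)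

lemma expDeg_eq_degree {n : ℕ} (μ : Fin n →₀ ℕ) : expDeg μ = μ.degree := rfl

lemma IsGenericSeq.of_snoc {F K : Type*} [CommRing F] [CommRing K] [Algebra F K] {n r : ℕ}
    {d : Fin r → ℕ} {D : ℕ} {f : Fin r → MvPolynomial (Fin n) K} {g : MvPolynomial (Fin n) K}
    (h : IsGenericSeq F (Fin.snoc d D : Fin (r + 1) → ℕ)
      (Fin.snoc f g : Fin (r + 1) → MvPolynomial (Fin n) K)) : IsGenericSeq F d f := by
  refine ⟨fun i => by simpa using h.1 i.castSucc, ?_⟩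
  let φ : (Σ i : Fin r, { μ : Fin n →₀ ℕ // expDeg μ = d i }) →
      Σ i : Fin (r + 1), { μ : Fin n →₀ ℕ // expDeg μ = (Fin.snoc d D : Fin (r + 1) → ℕ) i } :=
    fun p => ⟨p.1.castSucc, p.2.1, by rw [Fin.snoc_castSucc]; exact p.2.2⟩
  have hφ : Function.Injective φ := by
    rintro ⟨i, μ, hμ⟩ ⟨j, ν, hν⟩ hij
    have hi : i = j := Fin.castSucc_injective r (congrArg Sigma.fst hij)
    subst hi
    simpa [φ] using hij
  convert h.2.comp φ hφ using 2 with p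
  simp [φ]

/-- If every monomial in a finite set `A` is congruent, modulo monomials outside `A`, to an element
of the ideal of some forms of degrees `d i`, then the same holds for generic forms. -/
lemma IsGenericSeq.exists_mem_span_coeff_eq {F K : Type*} [Field F] [Field K] [Algebra F K]
    {n r : ℕ} {d : Fin r → ℕ} {f f₀ : Fin r → MvPolynomial (Fin n) K} (hf : IsGenericSeq F d f)
    (hf₀ : ∀ i, (f₀ i).IsHomogeneous (d i)) (A : Finset (Fin n →₀ ℕ))
    (h : ∀ α ∈ A, ∃ q ∈ Ideal.span (Set.range f₀),
      ∀ β ∈ A, q.coeff β = if β = α then 1 else 0) :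
    ∀ α ∈ A, ∃ q ∈ Ideal.span (Set.range f), ∀ β ∈ A, q.coeff β = if β = α then 1 else 0 := by
  classical
  let π : MvPolynomial (Fin n) K →ₗ[K] (A → K) := LinearMap.pi fun β => lcoeff K β.1
  let M (β : A) (q : Fin r × (Fin n →₀ ℕ)) :
      MvPolynomial (Σ i : Fin r, { μ : Fin n →₀ ℕ // expDeg μ = d i }) F :=
    if hq : q.2 ≤ β ∧ expDeg (β.1 - q.2) = d q.1 then X ⟨q.1, β.1 - q.2, hq.2⟩ else 0
  have hM : ∀ g : Fin r → MvPolynomial (Fin n) K, (∀ i, (g i).IsHomogeneous (d i)) →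
      ((Ideal.span (Set.range g)).restrictScalars K).map π = Submodule.span K (Set.range fun q β =>
        aeval (fun p : Σ i : Fin r, { μ : Fin n →₀ ℕ // expDeg μ = d i } => (g p.1).coeff p.2.1)
          (M β q)) := by
    intro g hg
    rw [restrictScalars_ideal_span_range, Submodule.map_span, ← Set.range_comp]
    congr 2
    funext q β
    simp only [π, M, Function.comp_apply, LinearMap.pi_apply, lcoeff_apply, coeff_monomial_mul',
      one_mul]
    by_cases h₁ : q.2 ≤ β
    · by_cases h₂ : expDeg (β.1 - q.2) = d q.1
      · rw [dif_pos ⟨h₁, h₂⟩, if_pos h₁, aeval_X]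
      · rw [dif_neg (fun hq => h₂ hq.2), if_pos h₁, (hg q.1).coeff_eq_zero h₂, map_zero]
    · rw [dif_neg (fun hq => h₁ hq.1), if_neg h₁, map_zero]
  have hπ : ∀ (q : MvPolynomial (Fin n) K) (α : A),
      π q = Pi.single α 1 ↔ ∀ β ∈ A, q.coeff β = if β = α then 1 else 0 := by
    intro q α
    rw [funext_iff, Subtype.forall]
    simp only [π, LinearMap.pi_apply, lcoeff_apply, Pi.single_apply, Subtype.ext_iff]
  have htop := span_range_aeval_eq_top M hf.2 (c₀ := fun p => (f₀ p.1).coeff p.2.1) (by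
    rw [← hM f₀ hf₀, eq_top_iff, ← (Pi.basisFun K A).span_eq, Submodule.span_le]
    rintro _ ⟨α, rfl⟩
    obtain ⟨q, hq, hqA⟩ := h α.1 α.2
    exact ⟨q, hq, by rw [Pi.basisFun_apply]; exact (hπ q α).2 hqA⟩)
  rw [← hM f hf.1] at htop
  intro α hα
  obtain ⟨q, hq, hqα⟩ := htop.ge (Submodule.mem_top (x := Pi.single ⟨α, hα⟩ 1))
  exact ⟨q, hq, (hπ q ⟨α, hα⟩).1 hqα⟩

lemma homogeneousComponent_mem_span_range {σ K κ : Type*} [CommRing K]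
    {f : κ → MvPolynomial σ K} {d : κ → ℕ} (hf : ∀ i, (f i).IsHomogeneous (d i))
    {p : MvPolynomial σ K} (hp : p ∈ Ideal.span (Set.range f)) (N : ℕ) :
    homogeneousComponent N p ∈ Ideal.span (Set.range f) := by
  let := MvPolynomial.gradedAlgebra (σ := σ) (R := K)
  refine homogeneousComponent_mem_of_mem (Ideal.homogeneous_span _ _ ?_) hp N
  rintro _ ⟨i, rfl⟩
  exact ⟨d i, hf i⟩

end Specialization

section Monomials

lemma prod_pow_eq_monomial {m : ℕ} {K : Type*} [CommRing K] {x : ℕ → MvPolynomial (Fin (m + 1)) K}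
    (hx : ∀ i : Fin (m + 1), x (i + 1) = X i) {ν : Fin (m + 1) →₀ ℕ} {e : ℕ → ℕ}
    (he : ∀ i : Fin (m + 1), e i = ν i) :
    ∏ i ∈ Finset.range (m + 1), x (i + 1) ^ e i = monomial ν 1 := by
  rw [Finset.prod_range, monomial_eq, C_1, one_mul, Finsupp.prod_fintype _ _ (by simp)]
  exact Finset.prod_congr rfl fun i _ => by rw [hx, he]

lemma sum_eq_expDeg {m : ℕ} {ν : Fin (m + 1) →₀ ℕ} {e : ℕ → ℕ}
    (he : ∀ i : Fin (m + 1), e i = ν i) : ∑ i ∈ Finset.range (m + 1), e i = expDeg ν := by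
  rw [Finset.sum_range, expDeg, Finsupp.sum_fintype _ _ (by simp)]
  exact Finset.sum_congr rfl fun i _ => he i

lemma isHomogeneous_binaryForm {σ K : Type*} [Field K] {x y : MvPolynomial σ K}
    (hx : x.IsHomogeneous 1) (hy : y.IsHomogeneous 1) (p : Polynomial K) (b : ℕ) :
    (binaryForm p b x y).IsHomogeneous b := by
  rw [binaryForm_eq_sum]
  refine IsHomogeneous.sum _ _ _ fun t ht => ?_
  have hdeg : 1 * t + 1 * (b - t) = b := by have := Finset.mem_range.1 ht; omega
  have := (hx.pow t).mul (hy.pow (b - t))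
  rw [hdeg] at this
  exact (homogeneousSubmodule σ K b).smul_mem _ this

/-- There are forms of degrees `d i` in `x_1, …, x_{m+1}` whose ideal, together with `x_{m+1}`,
contains all monomials in `x_1, …, x_m` of every degree `N` above the socle degree of the first `m`
forms or above half the socle degree of all of them. -/
lemma exists_forms_monomial_mem_sup (K : Type*) [Field K] [Infinite K] {m : ℕ}
    (d : Fin (m + 1) → ℕ) {N : ℕ}
    (hN : ∑ i : Fin m, (d i.castSucc - 1) < N ∨ ∑ i, (d i - 1) < 2 * N) :
    ∃ f₀ : Fin (m + 1) → MvPolynomial (Fin (m + 2)) K, (∀ i, (f₀ i).IsHomogeneous (d i)) ∧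
      ∀ ν : Fin (m + 2) →₀ ℕ, expDeg ν = N → ν (Fin.last (m + 1)) = 0 →
        ν (Fin.last m).castSucc = 0 →
          monomial ν 1 ∈ Ideal.span (Set.range f₀) ⊔ Ideal.span {X (Fin.last m).castSucc} := by
  classical
  let b : ℕ → ℕ := fun i => if h : i < m + 1 then d ⟨i, h⟩ else 1
  let x : ℕ → MvPolynomial (Fin (m + 2)) K := fun i =>
    if h : 1 ≤ i ∧ i - 1 < m + 2 then X ⟨i - 1, h.2⟩ else 0
  have hb : ∀ i : Fin (m + 1), b i = d i := fun i => dif_pos i.2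
  have hx : ∀ i : Fin (m + 2), x (i + 1) = X i := fun i => dif_pos ⟨by omega, i.2⟩
  have hx₀ : x 0 = 0 := dif_neg (by simp)
  have hxh : ∀ i, (x i).IsHomogeneous 1 := by
    intro i
    simp only [x]
    split_ifs
    · exact isHomogeneous_X _ _
    · exact isHomogeneous_zero _ _ _
  choose p hp using fun i =>
    exists_toeplitzRegular K (b i) (∑ i ∈ Finset.range (m + 1), (b i - 1) + 1)
  let f₀ : Fin (m + 1) → MvPolynomial (Fin (m + 2)) K := fun i =>
    binaryForm (p i) (b i) (x i) (x (i + 1))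
  have hspan : chainIdeal p b x (m + 1) = Ideal.span (Set.range f₀) := by
    refine congrArg Ideal.span (Set.ext fun w => ?_)
    simp only [Set.mem_image, Set.mem_Iio, Set.mem_range, f₀]
    exact ⟨fun ⟨i, hi, hw⟩ => ⟨⟨i, hi⟩, hw⟩, fun ⟨i, hw⟩ => ⟨i, i.2, hw⟩⟩
  refine ⟨f₀, fun i => hb i ▸ isHomogeneous_binaryForm (hxh _) (hxh _) _ _,
    fun ν hν h₁ h₂ => ?_⟩
  let e : ℕ → ℕ := fun i => if h : i < m + 2 then ν ⟨i, h⟩ else 0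
  have he : ∀ i : Fin (m + 2), e i = ν i := fun i => dif_pos i.2
  have he₁ : e (m + 1) = 0 := (he (Fin.last (m + 1))).trans h₁
  have he₂ : e m = 0 := (he (Fin.last m).castSucc).trans h₂
  have hprod := prod_pow_eq_monomial hx he
  have hsum := sum_eq_expDeg he
  rw [Finset.prod_range_succ, he₁, pow_zero, mul_one] at hprod
  rw [Finset.sum_range_succ, he₁, add_zero, hν] at hsum
  rw [← hspan, ← hx, Fin.val_castSucc, Fin.val_last]
  rcases hN with hN | hN
  · rw [Finset.prod_range_succ, he₂, pow_zero, mul_one] at hprod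
    rw [Finset.sum_range_succ, he₂, add_zero] at hsum
    rw [← hprod]
    refine Ideal.mem_sup_left (chainIdeal_mono p b x (Nat.le_succ m)
      (prod_pow_mem_chainIdeal hx₀ hp e (by rw [Finset.sum_range_succ]; omega) ?_))
    rw [hsum, Finset.sum_range]
    convert hN using 4 with i
    exact hb i.castSucc
  · rw [← hprod]
    refine prod_pow_mem_chainIdeal_sup hx₀ hp e le_rfl ?_
    rw [hsum, Finset.sum_range]
    simpa only [hb] using hN

lemma IsGenericSeq.exists_homogeneous_mem {F K : Type*} [Field F] [Field K] [Algebra F K]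
    [Infinite K] {m : ℕ} {d : Fin (m + 1) → ℕ} {f : Fin (m + 1) → MvPolynomial (Fin (m + 2)) K}
    (hf : IsGenericSeq F d f) {N : ℕ}
    (hN : ∑ i : Fin m, (d i.castSucc - 1) < N ∨ ∑ i, (d i - 1) < 2 * N)
    {ν : Fin (m + 2) →₀ ℕ} (hν : expDeg ν = N) (h₁ : ν (Fin.last (m + 1)) = 0)
    (h₂ : ν (Fin.last m).castSucc = 0) :
    ∃ p ∈ Ideal.span (Set.range f), p.IsHomogeneous N ∧ p.coeff ν = 1 ∧
      ∀ β, p.coeff β ≠ 0 → β ≠ ν → β (Fin.last (m + 1)) = 0 → β (Fin.last m).castSucc ≠ 0 := by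
  classical
  obtain ⟨f₀, hf₀, hmem⟩ := exists_forms_monomial_mem_sup K d hN
  let A : Finset (Fin (m + 2) →₀ ℕ) := (Finset.finsuppAntidiag Finset.univ N).filter fun β =>
    β (Fin.last (m + 1)) = 0 ∧ β (Fin.last m).castSucc = 0
  have hA : ∀ β, β ∈ A ↔ expDeg β = N ∧ β (Fin.last (m + 1)) = 0 ∧
      β (Fin.last m).castSucc = 0 := by
    intro β
    rw [Finset.mem_filter, Finset.mem_finsuppAntidiag']
    simp [expDeg]
  obtain ⟨q, hq, hqA⟩ := hf.exists_mem_span_coeff_eq hf₀ A (fun α hα => by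
    rw [hA] at hα
    obtain ⟨q, hq, s, hs, hqs⟩ := Submodule.mem_sup.1 (hmem α hα.1 hα.2.1 hα.2.2)
    obtain ⟨t, rfl⟩ := Ideal.mem_span_singleton.1 hs
    refine ⟨q, hq, fun β hβ => ?_⟩
    rw [eq_sub_of_add_eq hqs, coeff_sub, coeff_monomial, mul_comm, coeff_mul_X',
      if_neg (c := _ ∈ β.support), sub_zero]
    · simp only [eq_comm]
    · simpa using ((hA β).1 hβ).2.2) ν ((hA ν).2 ⟨hν, h₁, h₂⟩)
  refine ⟨homogeneousComponent N q, homogeneousComponent_mem_span_range hf.1 hq N,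
    homogeneousComponent_isHomogeneous N q, ?_, fun β hβ hne hlast hβ' => hβ ?_⟩
  · rw [coeff_homogeneousComponent, ← expDeg_eq_degree, if_pos hν,
      hqA ν ((hA ν).2 ⟨hν, h₁, h₂⟩), if_pos rfl]
  · rw [coeff_homogeneousComponent, ← expDeg_eq_degree]
    split_ifs with hd
    · rw [hqA β ((hA β).2 ⟨hd, hlast, hβ'⟩), if_neg hne]
    · rfl

lemma embExp_castSucc {n : ℕ} (μ : Fin n →₀ ℕ) (j : Fin n) : embExp μ j.castSucc = μ j :=
  Finsupp.embDomain_apply_self ⟨Fin.castSucc, Fin.castSucc_injective n⟩ μ j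

lemma embExp_last {n : ℕ} (μ : Fin n →₀ ℕ) : embExp μ (Fin.last n) = 0 :=
  Finsupp.embDomain_of_notMem_range _ _ _ (by simp)

lemma embExp_injective {n : ℕ} : Function.Injective (embExp (n := n)) :=
  Finsupp.embDomain_injective _

lemma expDeg_embExp {n : ℕ} (μ : Fin n →₀ ℕ) : expDeg (embExp μ) = expDeg μ := by
  rw [expDeg, expDeg, embExp, Finsupp.sum_embDomain]

lemma coeff_projMap {n : ℕ} {K : Type*} [CommRing K] (p : MvPolynomial (Fin (n + 1)) K)
    (β : Fin n →₀ ℕ) : (projMap K n p).coeff β = p.coeff (embExp β) := by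
  classical
  induction p using MvPolynomial.induction_on' with
  | add p q hp hq => rw [map_add, coeff_add, coeff_add, hp, hq]
  | monomial u a =>
    rw [projMap, aeval_monomial, Finsupp.prod_fintype _ _ (by simp), Fin.prod_univ_castSucc,
      coeff_monomial]
    simp only [Fin.lastCases_castSucc, Fin.lastCases_last]
    by_cases hu : u (Fin.last n) = 0
    · obtain ⟨v, rfl⟩ : ∃ v, u = embExp v := by
        refine ⟨Finsupp.equivFunOnFinite.symm fun j => u j.castSucc, Finsupp.ext fun i => ?_⟩
        refine Fin.lastCases ?_ (fun j => ?_) i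
        · rw [hu, embExp_last]
        · simp [embExp_castSucc]
      have hv := monomial_eq (s := v) (a := (1 : K))
      rw [C_1, one_mul, Finsupp.prod_fintype _ _ (by simp)] at hv
      simp only [embExp_castSucc, embExp_last, pow_zero, mul_one, ← hv, algebraMap_eq, coeff_C_mul,
        coeff_monomial, embExp_injective.eq_iff, mul_ite, mul_zero]
    · rw [zero_pow hu, mul_zero, mul_zero, coeff_zero, if_neg]
      rintro rfl
      exact hu (embExp_last β)

lemma IsLeadExp.monomial_mem_initialIdeal {n : ℕ} {K : Type*} [CommRing K]
    {I : Ideal (MvPolynomial (Fin n) K)} {p : MvPolynomial (Fin n) K} {μ : Fin n →₀ ℕ}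
    (h : IsLeadExp p μ) (hp : p ∈ I) : monomial μ (1 : K) ∈ initialIdeal I :=
  Ideal.subset_span ⟨p, hp, fun h₀ => by simpa [h₀] using h.1, μ, h, rfl⟩

lemma MvPolynomial.IsHomogeneous.expDeg_eq {n N : ℕ} {K : Type*} [CommRing K]
    {p : MvPolynomial (Fin n) K} (hp : p.IsHomogeneous N) {β : Fin n →₀ ℕ} (hβ : p.coeff β ≠ 0) :
    expDeg β = N := by
  by_contra h
  exact hβ (hp.coeff_eq_zero h)

variable {F K : Type*} [Field F] [Field K] [Algebra F K] [Infinite K] {m : ℕ}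
  {d : Fin (m + 1) → ℕ} {f : Fin (m + 1) → MvPolynomial (Fin (m + 2)) K}

lemma IsGenericSeq.monomial_mem_initialIdeal (hf : IsGenericSeq F d f) {N : ℕ}
    (hN : ∑ i : Fin m, (d i.castSucc - 1) < N ∨ ∑ i, (d i - 1) < 2 * N)
    {ν : Fin (m + 2) →₀ ℕ} (hν : expDeg ν = N) (h₁ : ν (Fin.last (m + 1)) = 0)
    (h₂ : ν (Fin.last m).castSucc = 0) :
    monomial ν (1 : K) ∈ initialIdeal (Ideal.span (Set.range f)) := by
  obtain ⟨p, hp, hph, hpν, hpβ⟩ := hf.exists_homogeneous_mem hN hν h₁ h₂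
  refine IsLeadExp.monomial_mem_initialIdeal ⟨by simp [hpν], fun β hβ hne => ?_⟩ hp
  rw [mem_support_iff] at hβ
  refine Or.inr ⟨(hph.expDeg_eq hβ).trans hν.symm, ?_⟩
  by_cases hlast : β (Fin.last (m + 1)) = 0
  · refine ⟨(Fin.last m).castSucc, ?_, fun j hj => ?_⟩
    · rw [h₂]
      exact Nat.pos_of_ne_zero (hpβ β hβ hne hlast)
    · obtain rfl : j = Fin.last (m + 1) := by
        simp only [Fin.lt_def, Fin.val_castSucc, Fin.val_last] at hj
        ext
        rw [Fin.val_last]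
        omega
      rw [hlast, h₁]
  · exact ⟨Fin.last (m + 1), by rw [h₁]; exact Nat.pos_of_ne_zero hlast,
      fun j hj => absurd hj (Fin.le_last j).not_gt⟩

lemma IsGenericSeq.monomial_mem_initialIdeal_map (hf : IsGenericSeq F d f) {N : ℕ}
    (hN : ∑ i : Fin m, (d i.castSucc - 1) < N ∨ ∑ i, (d i - 1) < 2 * N)
    {μ : Fin (m + 1) →₀ ℕ} (hμ : expDeg μ = N) (h : μ (Fin.last m) = 0) :
    monomial μ (1 : K) ∈
      initialIdeal ((Ideal.span (Set.range f)).map (projMap K (m + 1))) := by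
  obtain ⟨p, hp, hph, hpμ, hpβ⟩ := hf.exists_homogeneous_mem hN
    ((expDeg_embExp μ).trans hμ) (embExp_last μ) ((embExp_castSucc μ _).trans h)
  refine IsLeadExp.monomial_mem_initialIdeal ⟨by simp [coeff_projMap, hpμ], fun β hβ hne => ?_⟩
    (Ideal.mem_map_of_mem _ hp)
  rw [mem_support_iff, coeff_projMap] at hβ
  refine Or.inr ⟨?_, Fin.last m, ?_, fun j hj => absurd hj (Fin.le_last j).not_gt⟩
  · rw [hμ, ← expDeg_embExp, hph.expDeg_eq hβ]
  · have := hpβ _ hβ (embExp_injective.ne hne) (embExp_last β)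
    rw [embExp_castSucc] at this
    rw [h]
    exact Nat.pos_of_ne_zero this

lemma initialIdeal_mono {n : ℕ} {R : Type*} [CommRing R] :
    Monotone (initialIdeal (n := n) (K := R)) := fun _ _ h =>
  Ideal.span_mono fun _ ⟨p, hp, hμ⟩ => ⟨p, h hp, hμ⟩

end Monomials

/-- if `σ ≤ d < δ`, then every monomial of `B_{d+1} ∪ ⋯ ∪ B_{d+i*}` is
divisible by `x_n`, and consequently every generator of `in(I,g)` lying in some `B_{d+i}`
(`1 ≤ i ≤ i*`) satisfies property `P`. -/
theorem stmt10 {F K : Type*} [Field F] [Field K] [Algebra F K] [Infinite K]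
    {n : ℕ} (hn : 0 < n) (d : Fin n → ℕ) (hd : ∀ i, 1 ≤ d i) (hmono : Monotone d)
    (D : ℕ) (hdD : ∀ i, d i ≤ D)
    (f : Fin n → MvPolynomial (Fin (n + 1)) K) (g : MvPolynomial (Fin (n + 1)) K)
    (hfg : IsGenericSeq F (Fin.snoc d D) (Fin.snoc f g))
    (I Ig : Ideal (MvPolynomial (Fin (n + 1)) K))
    (hI : I = Ideal.span (Set.range f)) (hIg : Ig = Ideal.span (Set.range (Fin.snoc f g)))
    (J : Ideal (MvPolynomial (Fin n) K)) (hJ : J = I.map (projMap K n))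
    (δ δs σ istar : ℕ) (hδ : δ = (∑ j, d j) - n)
    (hδs : δs = (∑ j ∈ Finset.univ.filter (fun j : Fin n => (j : ℕ) < n - 1), d j) - (n - 1))
    (hσ : σ = min δs (δ / 2))
    (hDδ : D < δ) (hσD : σ ≤ D) (histar : istar = (δ - D) / 2) :
    (∀ i ∈ Finset.Icc 1 istar, ∀ μ ∈ stdMon J (D + i), μ ⟨n - 1, by omega⟩ ≠ 0) ∧
    (∀ i ∈ Finset.Icc 1 istar, ∀ μ ∈ stdMon J (D + i),
      monomial (embExp μ) (1 : K) ∈ initialIdeal Ig →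
        SatisfiesP (initialIdeal Ig) (embExp μ)) := by
  obtain ⟨m, rfl⟩ := Nat.exists_eq_add_of_le' hn
  have hf := hfg.of_snoc
  have hsub : ∀ {r : ℕ} (c : Fin r → ℕ), (∀ i, 1 ≤ c i) → ∑ i, (c i - 1) = ∑ i, c i - r := by
    intro r c hc
    rw [Finset.sum_tsub_distrib _ fun i _ => hc i]
    simp
  have hδs' : ∑ i : Fin m, (d i.castSucc - 1) = δs := by
    rw [hδs, hsub _ fun i => hd _, Finset.sum_filter, Fin.sum_univ_castSucc]
    simp
  have hδ' : ∑ i, (d i - 1) = δ := by rw [hδ, hsub d hd]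
  have hN : ∀ i ∈ Finset.Icc 1 istar,
      ∑ j : Fin m, (d j.castSucc - 1) < D + i ∨ ∑ j, (d j - 1) < 2 * (D + i) := by
    intro i hi
    rw [hδs', hδ']
    have := (Finset.mem_Icc.1 hi).1
    omega
  have hlast : ∀ i ∈ Finset.Icc 1 istar, ∀ μ ∈ stdMon J (D + i), μ (Fin.last m) ≠ 0 := by
    intro i hi μ hμ h
    refine hμ.2 ?_
    rw [hJ, hI]
    exact hf.monomial_mem_initialIdeal_map (hN i hi) hμ.1 h
  refine ⟨hlast, fun i hi μ hμ _ k hk hkj ν hν hνj => ?_⟩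
  have hkm : (Fin.last m).castSucc = k := by
    refine le_antisymm (not_lt.1 fun hlt => hlast i hi μ hμ ?_) (not_lt.1 fun hlt => hk ?_)
    · rw [← embExp_castSucc, hkj _ hlt]
    · obtain rfl : k = Fin.last (m + 1) := by
        simp only [Fin.lt_def, Fin.val_castSucc, Fin.val_last] at hlt
        ext
        rw [Fin.val_last]
        omega
      exact embExp_last μ
  have hle : Ideal.span (Set.range f) ≤ Ig := by
    rw [hIg]
    refine Ideal.span_mono (Set.range_subset_iff.2 fun j => ⟨j.castSucc, ?_⟩)
    rw [Fin.snoc_castSucc]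
  refine initialIdeal_mono hle (hf.monomial_mem_initialIdeal (hN i hi) ?_
    (hνj _ (Fin.le_last k)) (hνj _ hkm.ge))
  rw [hν, expDeg_embExp, hμ.1]
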